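/- Take the parameters ϱ_l in the differential operators to be the moments of the measure, with ϱ₀ ≠ 0, and let λ ∈ ℝ. For every finite index set J, every M ∈ ℕ, and every smooth function F of (ϱ₀, …, ϱ_M; (z_i)_{i∈J}), applying K̂ to the z₁-dependence of (2λ)³·Â†_{z_J,z₁}F gives, for every admissible z₁: K̂_{z₁}((2λ)³Â†_{z_J,z₁}F) = (8λ³/z₁²)·(Σ_{l=0}^{M}(3+2l)·(∂F/∂ϱ_l)·Σ_{k=0}^{l} ϱ_k/z₁^{2+2l−2k} + Σ_{β∈J}(1/z_β)·∂F/∂z_β). -/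

import Mathlib

open scoped BigOperators
open MeasureTheory

noncomputable section

namespace NCQFT

/-! ### Measure data: the planar 1‑point function `G0fun`, the moments and the operator `K̂`. -/

/-- The planar one-point function `𝒢₀(z) = s·z − n̄ + ½∫ᵃᵇ r(y)/((z+y)y) dy`. -/
def G0fun (a b s nbar : ℝ) (r : ℝ → ℝ) (z : ℂ) : ℂ :=
  (s : ℂ) * z - (nbar : ℂ) + (1 / 2) * ∫ y in a..b, (r y : ℂ) / ((z + (y : ℂ)) * (y : ℂ))

/-- Moments `ϱ_l = s·δ_{l,0} − ½∫ᵃᵇ r(y)/y^{3+2l} dy` of the measure. -/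
def moment (a b s : ℝ) (r : ℝ → ℝ) (l : ℕ) : ℝ :=
  (if l = 0 then s else 0) - (1 / 2) * ∫ y in a..b, r y / y ^ (3 + 2 * l)

/-- The integral operator `K̂`. -/
def Khat (a b s nbar : ℝ) (r : ℝ → ℝ) (f : ℂ → ℂ) (z : ℂ) : ℂ :=
  G0fun a b s nbar r z * f z + (nbar : ℂ) * f z
    + (1 / 2) * ∫ y in a..b, (r y : ℂ) * (f z - f (y : ℂ)) / (z ^ 2 - (y : ℂ) ^ 2)

/-- Admissible points: `z ∉ [a,b] ∪ (−[a,b]) ∪ {0}`. -/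
def Admissible (a b : ℝ) (z : ℂ) : Prop :=
  z ≠ 0 ∧ ∀ y : ℝ, y ∈ Set.Icc a b → z ≠ (y : ℂ) ∧ z ≠ -(y : ℂ)

/-! ### Partial Bell polynomials and the polynomials `S_m(ϱ)`. -/

/-- Partial Bell polynomial `B_{n,k}(x₁,…,x_{n−k+1})`. -/
def bellP (n k : ℕ) (x : ℕ → ℝ) : ℝ :=
  ∑ j : Fin n → Fin (n + 1),
    if (∑ i : Fin n, (j i : ℕ)) = k ∧ (∑ i : Fin n, ((i : ℕ) + 1) * (j i : ℕ)) = n then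
      (n.factorial : ℝ) / (∏ i : Fin n, ((j i : ℕ).factorial : ℝ)) *
        ∏ i : Fin n, (x ((i : ℕ) + 1) / (((i : ℕ) + 1).factorial : ℝ)) ^ (j i : ℕ)
    else 0

/-- `S_m(ϱ) = Σ_{i=0}^m (−1)^i i! ϱ₀^{−i} B_{m,i}(1!ϱ₁,…,(m−i+1)!ϱ_{m−i+1})`. -/
def Sm (ρ : ℕ → ℝ) (m : ℕ) : ℝ :=
  ∑ i ∈ Finset.range (m + 1),
    (-1) ^ i * (i.factorial : ℝ) * ((ρ 0)⁻¹) ^ i *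
      bellP m i (fun j => (j.factorial : ℝ) * ρ j)

/-! ### Partial derivatives in the moment variables. -/

/-- Partial derivative `∂/∂ϱ_l` of a real-valued function of the moments. -/
def pdR (c : (ℕ → ℝ) → ℝ) (l : ℕ) (ρ : ℕ → ℝ) : ℝ :=
  deriv (fun t => c (Function.update ρ l t)) (ρ l)

/-- Partial derivative `∂/∂ϱ_l` of a complex-valued function of the moments. -/
def pdC (c : (ℕ → ℝ) → ℂ) (l : ℕ) (ρ : ℕ → ℝ) : ℂ :=
  deriv (fun t : ℝ => c (Function.update ρ l t)) (ρ l)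

/-! ### Boundary creation operators. -/

/-- Boundary creation operator `Â†_{z_J,w}` with free creation variable `w`, acting on a
family `F` of the moments `ϱ` and boundary variables `(z_i)_{i∈J}`. -/
def AdagFree (J : Finset ℕ) (F : (ℕ → ℝ) → (ℕ → ℂ) → ℂ)
    (ρ : ℕ → ℝ) (z : ℕ → ℂ) (w : ℂ) : ℂ :=
  (∑' l : ℕ, (-((3 + 2 * (l : ℂ)) * (ρ (l + 1) : ℂ)) / ((ρ 0 : ℂ) * w ^ 3)
      + (3 + 2 * (l : ℂ)) / w ^ (5 + 2 * l)) * pdC (fun σ => F σ z) l ρ)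
  + ∑ i ∈ J, (1 / ((ρ 0 : ℂ) * w ^ 3 * z i)) *
      deriv (fun v => F ρ (Function.update z i v)) (z i)

/-- Boundary creation operator creating a boundary at coordinate `p`. -/
def AdagVar (J : Finset ℕ) (p : ℕ) (F : (ℕ → ℝ) → (ℕ → ℂ) → ℂ) :
    (ℕ → ℝ) → (ℕ → ℂ) → ℂ :=
  fun ρ z => AdagFree J F ρ z (z p)

/-- Boundary creation operator `Â†_w` acting on scalar functions of the moments only. -/
def AdagScalar (F : (ℕ → ℝ) → ℝ) (ρ : ℕ → ℝ) (w : ℂ) : ℂ :=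
  ∑' l : ℕ, (-((3 + 2 * (l : ℂ)) * (ρ (l + 1) : ℂ)) / ((ρ 0 : ℂ) * w ^ 3)
      + (3 + 2 * (l : ℂ)) / w ^ (5 + 2 * l)) * (pdR F l ρ : ℂ)

/-! ### The genus recursion for the 1-boundary functions `𝒢_g(z) = Σ_k c_{g,k}(ϱ)/z^{2k+3}`. -/

/-- Coefficients `e_m(ϱ)` of the even bracket
`w²·(Σ_{h=1}^{g-1} G_h(w)G_{g−h}(w) + (2λ)²·G_{g−1}(w|w))`, expressed through the table
`prev` of the coefficients of the lower-genus one-boundary functions. -/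
def eBr (lam : ℝ) (g : ℕ) (prev : ℕ → ℕ → (ℕ → ℝ) → ℝ) (m : ℕ) (ρ : ℕ → ℝ) : ℝ :=
  (∑ h ∈ Finset.Icc 1 (g - 1), ∑ i ∈ Finset.range (m + 1), ∑ j ∈ Finset.range (m + 1),
      if i + j + 2 = m then prev h i ρ * prev (g - h) j ρ else 0)
  + (2 * lam) ^ 4 *
    ((if 2 ≤ m then
        -(1 / ρ 0) * ∑' l : ℕ, (3 + 2 * (l : ℝ)) * ρ (l + 1) * pdR (prev (g - 1) (m - 2)) l ρ
      else 0)
    + (∑ k ∈ Finset.range (m + 1), ∑ l ∈ Finset.range (m + 1),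
        if k + l + 3 = m then (3 + 2 * (l : ℝ)) * pdR (prev (g - 1) k) l ρ else 0)
    + (if 3 ≤ m then -(((2 * (m - 3) + 3 : ℕ) : ℝ) * prev (g - 1) (m - 3) ρ) / ρ 0 else 0))

/-- Table of the coefficients of the one-boundary functions for all genera `h ≤ G`.
`Gtab lam G h k ρ` is the coefficient of `z^{-(2k+3)}` in `𝒢_h(z)`. -/
def Gtab (lam : ℝ) : ℕ → ℕ → ℕ → (ℕ → ℝ) → ℝ
  | 0 => fun _ _ _ => 0
  | 1 => fun h k ρ =>
      if h = 1 then
        (if k = 0 then 2 * lam ^ 4 * ρ 1 / (ρ 0) ^ 2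
         else if k = 1 then -(2 * lam ^ 4) / ρ 0 else 0)
      else 0
  | (G + 2) => fun h k ρ =>
      if h ≤ G + 1 then Gtab lam (G + 1) h k ρ
      else if h = G + 2 then
        -(1 / (2 * ρ 0)) *
          ∑' j : ℕ, eBr lam (G + 2) (Gtab lam (G + 1)) (k + j) ρ * Sm ρ j / (j.factorial : ℝ)
      else 0

/-- Coefficients of the genus-`g` one-boundary function. -/
def Gcoef (lam : ℝ) (g : ℕ) : ℕ → (ℕ → ℝ) → ℝ := Gtab lam g g

/-- One-boundary function `𝒢_g(z)` of genus `g ≥ 1`. -/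
def Gfun (lam : ℝ) (g : ℕ) (ρ : ℕ → ℝ) (z : ℂ) : ℂ :=
  ∑' k : ℕ, (Gcoef lam g k ρ : ℂ) / z ^ (2 * k + 3)

/-- The same-point two-boundary function `𝒢_g(z|z)`, with
`𝒢₀(z|z) := λ²/z⁴` and `𝒢_g(z|z) := (2λ)²(Â†_z + (1/(ϱ₀z⁴))∂_z)𝒢_g(z)` for `g ≥ 1`. -/
def Gpair (lam : ℝ) (g : ℕ) (ρ : ℕ → ℝ) (z : ℂ) : ℂ :=
  if g = 0 then (lam : ℂ) ^ 2 / z ^ 4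
  else (2 * (lam : ℂ)) ^ 2 *
    ((∑' l : ℕ, (-((3 + 2 * (l : ℂ)) * (ρ (l + 1) : ℂ)) / ((ρ 0 : ℂ) * z ^ 3)
        + (3 + 2 * (l : ℂ)) / z ^ (5 + 2 * l)) * pdC (fun σ => Gfun lam g σ z) l ρ)
     + (1 / ((ρ 0 : ℂ) * z ^ 4)) * deriv (Gfun lam g ρ) z)

/-! ### Multi-boundary functions. -/

/-- Iterated boundary creation for `g ≥ 1` (without prefactors); coordinates `0,…,B−1`. -/
def GBraw (lam : ℝ) (g : ℕ) : ℕ → (ℕ → ℝ) → (ℕ → ℂ) → ℂ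
  | 0 => fun _ _ => 0
  | 1 => fun ρ z => Gfun lam g ρ (z 0)
  | (B + 2) => AdagVar (Finset.range (B + 1)) (B + 1) (GBraw lam g (B + 1))

/-- Iterated boundary creation for `g = 0` (without prefactors), starting from `𝒢₀(z₁|z₂)`. -/
def GBraw0 (lam : ℝ) : ℕ → (ℕ → ℝ) → (ℕ → ℂ) → ℂ
  | 0 => fun _ _ => 0
  | 1 => fun _ _ => 0
  | 2 => fun _ z => 4 * (lam : ℂ) ^ 2 / (z 0 * z 1 * (z 0 + z 1) ^ 2)
  | (B + 3) => AdagVar (Finset.range (B + 2)) (B + 2) (GBraw0 lam (B + 2))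

/-- The multi-boundary functions `𝒢_g(z₁|…|z_B)`, with variables at coordinates `0,…,B−1`:
`𝒢_g(z₁|…|z_B) = (2λ)^{3B−4} Â†_{(z₁..z_{B−1}),z_B}(⋯ Â†_{(z₁),z₂}𝒢_g(z₁)⋯)` for `g ≥ 1`,
and `𝒢₀(z₁|…|z_B) = (2λ)^{3B−6} Â†(⋯ Â†𝒢₀(z₁|z₂)⋯)` for `g = 0`. -/
def GBfun (lam : ℝ) (g B : ℕ) (ρ : ℕ → ℝ) (z : ℕ → ℂ) : ℂ :=
  if g = 0 then (2 * (lam : ℂ)) ^ (3 * B - 6) * GBraw0 lam B ρ z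
  else if B = 1 then Gfun lam g ρ (z 0)
  else (2 * (lam : ℂ)) ^ (3 * B - 4) * GBraw lam g B ρ z

/-! ### Free energies and boundary annihilation. -/

/-- Boundary annihilation applied to `𝒢_g`:  `Â_ǎ 𝒢_g = −Σ_l ϱ_l/(3+2l) · c_{g,l+1}(ϱ)`
(the coefficient of `z^{−5−2l}` in `𝒢_g(z)` is `c_{g,l+1}`). -/
def AcheckG (lam : ℝ) (g : ℕ) (ρ : ℕ → ℝ) : ℝ :=
  -∑' l : ℕ, ρ l / (3 + 2 * (l : ℝ)) * Gcoef lam g (l + 1) ρ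

/-- Free energies: `F₁ = −(1/24)·log ϱ₀`, and
`F_g = (1/((2g−2)(2λ)⁴))·Â_ǎ(𝒢_g)` for `g ≥ 2`. -/
def Ffree (lam : ℝ) (g : ℕ) (ρ : ℕ → ℝ) : ℝ :=
  if g = 1 then -(1 / 24) * Real.log (ρ 0)
  else 1 / ((2 * (g : ℝ) - 2) * (2 * lam) ^ 4) * AcheckG lam g ρ

/-! ### Auxiliary notions. -/

/-- Variable assignment `(z₁, z_{i₁}, z_{i₂}, …)` with first slot `w` and the remaining slots
filled by the coordinates of `z` indexed by the set `I` in increasing order. -/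
def slotAt (z : ℕ → ℂ) (w : ℂ) (I : Finset ℕ) : ℕ → ℂ :=
  fun n => if n = 0 then w else z ((I.sort (· ≤ ·)).getD (n - 1) 0)

/-- A polynomial in variables `x₁,…,x_j` is `j`-weighted if each of its monomials
`∏ x_i^{m_i}` satisfies `Σ i·m_i = j`. -/
def IsWeighted (j : ℕ) (P : MvPolynomial (Fin j) ℚ) : Prop :=
  ∀ m ∈ P.support, (∑ i : Fin j, ((i : ℕ) + 1) * m i) = j

/-- A smooth family `F(ϱ₀,…,ϱ_M; (z_i)_{i∈J})`: it factors through a function of the first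
`M+1` moments and the coordinates in `J` which is smooth (and holomorphic in each `z_i`)
on the region `ϱ₀ ≠ 0`, `z_i ≠ 0`. -/
def SmoothFam (M : ℕ) (J : Finset ℕ) (F : (ℕ → ℝ) → (ℕ → ℂ) → ℂ) : Prop :=
  ∃ Ft : ((Fin (M + 1) → ℝ) × ({ i // i ∈ J } → ℂ)) → ℂ,
    ContDiffOn ℝ (⊤ : ℕ∞) Ft { x | x.1 0 ≠ 0 ∧ ∀ i, x.2 i ≠ 0 } ∧
    (∀ x ∈ ({ x : (Fin (M + 1) → ℝ) × ({ i // i ∈ J } → ℂ) |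
        x.1 0 ≠ 0 ∧ ∀ i, x.2 i ≠ 0 }), ∀ i,
      DifferentiableAt ℂ (fun w => Ft (x.1, Function.update x.2 i w)) (x.2 i)) ∧
    ∀ ρ z, F ρ z = Ft (fun l => ρ (l : ℕ), fun i => z (i : ℕ))

/-- A smooth scalar function of `ϱ₀ ≠ 0, ϱ₁, …, ϱ_M`. -/
def SmoothScalarFam (M : ℕ) (F : (ℕ → ℝ) → ℝ) : Prop :=
  ∃ Ft : (Fin (M + 1) → ℝ) → ℝ,
    ContDiffOn ℝ (⊤ : ℕ∞) Ft { v | v 0 ≠ 0 } ∧ ∀ ρ : ℕ → ℝ, F ρ = Ft (fun l => ρ (l : ℕ))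

/-! ### The Laplacian of Theorem `Δ_ϱ`. -/

/-- `R_m(ϱ) = −(2/3) Σ_{k=1}^m (kϱ_k/((3+2k)ϱ₀))·S_{m−k}(ϱ)/(m−k)!`. -/
def Rm (ρ : ℕ → ℝ) (m : ℕ) : ℝ :=
  -(2 / 3) * ∑ k ∈ Finset.Icc 1 m,
    ((k : ℝ) * ρ k / ((3 + 2 * (k : ℝ)) * ρ 0)) * (Sm ρ (m - k) / ((m - k).factorial : ℝ))

/-- The Laplacian `Δ_ϱ`, acting on functions of the moments. -/
def DeltaRho (F : (ℕ → ℝ) → ℝ) (ρ : ℕ → ℝ) : ℝ :=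
  -(-(6 * ρ 1 ^ 3) / (5 * ρ 0 ^ 3) + 111 * ρ 1 * ρ 2 / (70 * ρ 0 ^ 2)
      - ρ 3 / (2 * ρ 0)) * pdR (fun σ => pdR F 0 σ) 0 ρ
  - (2 * ρ 1 ^ 3 / ρ 0 ^ 4 - 1097 * ρ 1 * ρ 2 / (280 * ρ 0 ^ 3)
      + 41 * ρ 3 / (24 * ρ 0 ^ 2)) * pdR F 0 ρ
  - (∑' k : ℕ, (3 + 2 * ((k : ℝ) + 1)) *
      ((-(2 * ρ 1 ^ 2 / (5 * ρ 0 ^ 3)) + 2 * ρ 2 / (7 * ρ 0 ^ 2)) * ρ (k + 2)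
        - 3 * Rm ρ (k + 3) * ρ 1 / (2 * ρ 0) + 3 * Rm ρ (k + 4) / 2) *
      pdR (fun σ => pdR F 0 σ) (k + 1) ρ)
  - (∑' k : ℕ, ∑' l : ℕ, (3 + 2 * ((k : ℝ) + 1)) * (3 + 2 * ((l : ℝ) + 1)) *
      (-(ρ 1 * ρ (l + 2) * ρ (k + 2) / (30 * ρ 0 ^ 2))
        - ρ (k + 2) * Rm ρ (l + 3) / (4 * ρ 0)
        - ρ (l + 2) * Rm ρ (k + 3) / (4 * ρ 0)
        + Rm ρ (k + l + 5) / 4) *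
      pdR (fun σ => pdR F (l + 1) σ) (k + 1) ρ)
  - (∑' k : ℕ, (3 + 2 * ((k : ℝ) + 1)) *
      ((19 * ρ 1 ^ 2 / (60 * ρ 0 ^ 4) - 25 * ρ 2 / (84 * ρ 0 ^ 3)) * ρ (k + 2)
        + ρ 1 * Rm ρ (k + 3) / (16 * ρ 0 ^ 2)
        - Rm ρ (k + 4) / (16 * ρ 0)
        - (5 + 2 * ((k : ℝ) + 1)) * ρ 1 * ρ (k + 3) / (30 * ρ 0 ^ 3)
        - (5 + 2 * ((k : ℝ) + 1)) * Rm ρ (k + 4) / (2 * ρ 0)) *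
      pdR F (k + 1) ρ)

/-- The operator `D = −(2λ)⁴Δ_ϱ + (2λ)⁴·(−21ϱ₁³/(160ϱ₀⁵)+29ϱ₁ϱ₂/(128ϱ₀⁴)−35ϱ₃/(384ϱ₀³))·`. -/
def Dop (lam : ℝ) (F : (ℕ → ℝ) → ℝ) : (ℕ → ℝ) → ℝ :=
  fun ρ => -(2 * lam) ^ 4 * DeltaRho F ρ
    + (2 * lam) ^ 4 * (-(21 / 160) * ρ 1 ^ 3 / ρ 0 ^ 5 + (29 / 128) * ρ 1 * ρ 2 / ρ 0 ^ 4
        - (35 / 384) * ρ 3 / ρ 0 ^ 3) * F ρ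

end NCQFT

namespace NCQFT

/-- `K̂ f` at `z` has value `v`, with integrability of the integrand. -/
def HasK (a b s nbar : ℝ) (r : ℝ → ℝ) (z : ℂ) (f : ℂ → ℂ) (v : ℂ) : Prop :=
  IntervalIntegrable (fun y : ℝ => (r y : ℂ) * (f z - f (y : ℂ)) / (z ^ 2 - (y : ℂ) ^ 2))
    volume a b ∧ Khat a b s nbar r f z = v

lemma HasK.add {a b s nbar : ℝ} {r : ℝ → ℝ} {z : ℂ} {f g : ℂ → ℂ} {v w : ℂ}
    (hf : HasK a b s nbar r z f v) (hg : HasK a b s nbar r z g w) :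
    HasK a b s nbar r z (fun x => f x + g x) (v + w) := by
  have e : (fun y : ℝ => (r y : ℂ) * ((f z + g z) - (f (y : ℂ) + g (y : ℂ))) /
      (z ^ 2 - (y : ℂ) ^ 2)) = fun y : ℝ =>
      (r y : ℂ) * (f z - f (y : ℂ)) / (z ^ 2 - (y : ℂ) ^ 2) +
      (r y : ℂ) * (g z - g (y : ℂ)) / (z ^ 2 - (y : ℂ) ^ 2) := by
    funext y; ring
  refine ⟨?_, ?_⟩
  · rw [e]; exact hf.1.add hg.1
  · rw [← hf.2, ← hg.2]
    unfold Khat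
    rw [e, intervalIntegral.integral_add hf.1 hg.1]
    ring

lemma HasK.cmul {a b s nbar : ℝ} {r : ℝ → ℝ} {z : ℂ} {f : ℂ → ℂ} {v : ℂ} (c : ℂ)
    (hf : HasK a b s nbar r z f v) :
    HasK a b s nbar r z (fun x => c * f x) (c * v) := by
  have e : (fun y : ℝ => (r y : ℂ) * (c * f z - c * f (y : ℂ)) /
      (z ^ 2 - (y : ℂ) ^ 2)) = fun y : ℝ =>
      c * ((r y : ℂ) * (f z - f (y : ℂ)) / (z ^ 2 - (y : ℂ) ^ 2)) := by
    funext y; ring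
  refine ⟨?_, ?_⟩
  · rw [e]; exact hf.1.const_mul c
  · rw [← hf.2]
    unfold Khat
    rw [e, intervalIntegral.integral_const_mul]
    ring

lemma HasK.zero {a b s nbar : ℝ} {r : ℝ → ℝ} {z : ℂ} :
    HasK a b s nbar r z (fun _ => 0) 0 := by
  refine ⟨?_, ?_⟩ <;> simp [Khat]

lemma HasK.sum {a b s nbar : ℝ} {r : ℝ → ℝ} {z : ℂ} {ι : Type*} (S : Finset ι)
    {f : ι → ℂ → ℂ} {v : ι → ℂ} (hf : ∀ i ∈ S, HasK a b s nbar r z (f i) (v i)) :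
    HasK a b s nbar r z (fun x => ∑ i ∈ S, f i x) (∑ i ∈ S, v i) := by
  classical
  induction S using Finset.induction_on with
  | empty => simpa using HasK.zero
  | insert i S hi ih =>
    simp only [Finset.sum_insert hi]
    exact (hf i (Finset.mem_insert_self _ _)).add
      (ih fun j hj => hf j (Finset.mem_insert_of_mem hj))

lemma key_alg (z y : ℂ) (hz : z ≠ 0) (hy : y ≠ 0) (h1 : z ≠ y) (h2 : z ≠ -y) (n : ℕ) :
    1 / ((z + y) * y) * (z ^ (3 + 2 * n))⁻¹
      + ((z ^ (3 + 2 * n))⁻¹ - (y ^ (3 + 2 * n))⁻¹) / (z ^ 2 - y ^ 2)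
    = -∑ k ∈ Finset.range (n + 1), (z ^ (2 + 2 * n - 2 * k))⁻¹ * (y ^ (3 + 2 * k))⁻¹ := by
  have hm : z - y ≠ 0 := sub_ne_zero.mpr h1
  have hp : z + y ≠ 0 := fun h => h2 (eq_neg_of_add_eq_zero_left h)
  have hd : z ^ 2 - y ^ 2 = (z - y) * (z + y) := by ring
  induction n with
  | zero =>
    simp only [hd]
    simp
    field_simp
    ring
  | succ n ih =>
    rw [Finset.sum_range_succ]
    have e : ∑ k ∈ Finset.range (n + 1), (z ^ (2 + 2 * (n + 1) - 2 * k))⁻¹ * (y ^ (3 + 2 * k))⁻¹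
        = (z ^ 2)⁻¹ * ∑ k ∈ Finset.range (n + 1),
          (z ^ (2 + 2 * n - 2 * k))⁻¹ * (y ^ (3 + 2 * k))⁻¹ := by
      rw [Finset.mul_sum]
      refine Finset.sum_congr rfl fun k hk => ?_
      have hk' : k ≤ n := Nat.lt_succ_iff.mp (Finset.mem_range.mp hk)
      have : 2 + 2 * (n + 1) - 2 * k = (2 + 2 * n - 2 * k) + 2 := by omega
      rw [this, pow_add, mul_inv]
      ring
    have e2 : 2 + 2 * (n + 1) - 2 * (n + 1) = 2 := by omega
    rw [e, neg_add, ← mul_neg, ← ih, hd, e2]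
    have e3 : 3 + 2 * (n + 1) = (3 + 2 * n) + 2 := by ring
    rw [e3, pow_add z (3 + 2 * n) 2, pow_add y (3 + 2 * n) 2]
    have hzn : z ^ (3 + 2 * n) ≠ 0 := pow_ne_zero _ hz
    have hyn : y ^ (3 + 2 * n) ≠ 0 := pow_ne_zero _ hy
    generalize z ^ (3 + 2 * n) = Z at *
    generalize y ^ (3 + 2 * n) = Y at *
    field_simp
    ring

lemma moment_cast (a b s : ℝ) (r : ℝ → ℝ) (k : ℕ) :
    (moment a b s r k : ℂ) = (if k = 0 then (s : ℂ) else 0)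
      - (1 / 2) * ∫ y in a..b, (r y : ℂ) * ((y : ℂ) ^ (3 + 2 * k))⁻¹ := by
  have : (∫ y in a..b, (r y : ℂ) * ((y : ℂ) ^ (3 + 2 * k))⁻¹)
      = ((∫ y in a..b, r y / y ^ (3 + 2 * k) : ℝ) : ℂ) := by
    rw [← intervalIntegral.integral_ofReal]
    refine intervalIntegral.integral_congr fun y _ => ?_
    simp [div_eq_mul_inv]
  rw [this]
  unfold moment
  split_ifs <;> push_cast <;> ring

lemma hasK_mono (a b s nbar : ℝ) (r : ℝ → ℝ)
    (ha : 0 < a) (hab : a < b) (hr : ContinuousOn r (Set.Icc a b))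
    (z : ℂ) (hz : Admissible a b z) (n : ℕ) :
    HasK a b s nbar r z (fun w => (w ^ (3 + 2 * n))⁻¹)
      (∑ k ∈ Finset.range (n + 1), (moment a b s r k : ℂ) / z ^ (2 + 2 * n - 2 * k)) := by
  have hu : Set.uIcc a b = Set.Icc a b := Set.uIcc_of_le hab.le
  have hz0 := hz.1
  have hrc : ContinuousOn (fun y : ℝ => (r y : ℂ)) (Set.Icc a b) :=
    Complex.continuous_ofReal.comp_continuousOn hr
  have hc : Continuous (fun y : ℝ => (y : ℂ)) := Complex.continuous_ofReal
  have hy0 : ∀ y ∈ Set.Icc a b, (y : ℂ) ≠ 0 := fun y hy =>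
    Complex.ofReal_ne_zero.mpr (ha.trans_le hy.1).ne'
  have hp0 : ∀ y ∈ Set.Icc a b, z + (y : ℂ) ≠ 0 := fun y hy h =>
    (hz.2 y hy).2 (eq_neg_of_add_eq_zero_left h)
  have hd0 : ∀ y ∈ Set.Icc a b, z ^ 2 - (y : ℂ) ^ 2 ≠ 0 := fun y hy h => by
    have : (z - y) * (z + y) = 0 := by rw [← h]; ring
    rcases mul_eq_zero.mp this with h | h
    · exact (hz.2 y hy).1 (sub_eq_zero.mp h)
    · exact hp0 y hy h
  have hI1 : IntervalIntegrable (fun y : ℝ => (r y : ℂ) *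
      ((z ^ (3 + 2 * n))⁻¹ - ((y : ℂ) ^ (3 + 2 * n))⁻¹) / (z ^ 2 - (y : ℂ) ^ 2))
      volume a b := by
    apply ContinuousOn.intervalIntegrable
    rw [hu]
    refine ContinuousOn.div (hrc.mul (continuousOn_const.sub
      (ContinuousOn.inv₀ (by fun_prop) fun y hy => pow_ne_zero _ (hy0 y hy))))
      (by fun_prop) hd0
  have hI2 : IntervalIntegrable (fun y : ℝ => (r y : ℂ) / ((z + (y : ℂ)) * (y : ℂ)))
      volume a b := by
    apply ContinuousOn.intervalIntegrable
    rw [hu]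
    exact ContinuousOn.div hrc (by fun_prop) fun y hy => mul_ne_zero (hp0 y hy) (hy0 y hy)
  have hI3 : ∀ k : ℕ, IntervalIntegrable (fun y : ℝ => (r y : ℂ) * ((y : ℂ) ^ (3 + 2 * k))⁻¹)
      volume a b := fun k => by
    apply ContinuousOn.intervalIntegrable
    rw [hu]
    exact hrc.mul (ContinuousOn.inv₀ (by fun_prop) fun y hy => pow_ne_zero _ (hy0 y hy))
  refine ⟨hI1, ?_⟩
  have hmain : (∫ y in a..b, (r y : ℂ) / ((z + (y : ℂ)) * (y : ℂ))) * (z ^ (3 + 2 * n))⁻¹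
      + ∫ y in a..b, (r y : ℂ) *
      ((z ^ (3 + 2 * n))⁻¹ - ((y : ℂ) ^ (3 + 2 * n))⁻¹) / (z ^ 2 - (y : ℂ) ^ 2)
      = ∑ k ∈ Finset.range (n + 1), -(z ^ (2 + 2 * n - 2 * k))⁻¹ *
        ∫ y in a..b, (r y : ℂ) * ((y : ℂ) ^ (3 + 2 * k))⁻¹ := by
    rw [← intervalIntegral.integral_mul_const, ← intervalIntegral.integral_add
      (hI2.mul_const _) hI1]
    simp_rw [← intervalIntegral.integral_const_mul]
    rw [← intervalIntegral.integral_finsetSum fun k _ => (hI3 k).const_mul _]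
    refine intervalIntegral.integral_congr fun y hy => ?_
    rw [hu] at hy
    have := key_alg z y hz0 (hy0 y hy) (hz.2 y hy).1 (hz.2 y hy).2 n
    have h2 := congrArg (fun t => (r y : ℂ) * t) this
    simp only [mul_neg, Finset.mul_sum] at h2
    rw [← Finset.sum_neg_distrib] at h2
    calc _ = _ := by ring
      _ = _ := h2
      _ = _ := Finset.sum_congr rfl fun k _ => by ring
  have hs1 : ∑ k ∈ Finset.range (n + 1), (if k = 0 then (s : ℂ) else 0) /
      z ^ (2 + 2 * n - 2 * k) = s * z * (z ^ (3 + 2 * n))⁻¹ := by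
    rw [Finset.sum_eq_single 0]
    · have : 3 + 2 * n = (2 + 2 * n) + 1 := by ring
      simp only [if_true, mul_zero, Nat.sub_zero]
      rw [this, pow_succ]
      field_simp
    · intro k _ hk; simp [hk]
    · simp
  unfold Khat G0fun
  simp only [moment_cast, sub_div, Finset.sum_sub_distrib, hs1]
  have : ∑ k ∈ Finset.range (n + 1), (1 / 2 * ∫ y in a..b, (r y : ℂ) *
      ((y : ℂ) ^ (3 + 2 * k))⁻¹) / z ^ (2 + 2 * n - 2 * k) =
      -(1 / 2) * ∑ k ∈ Finset.range (n + 1), -(z ^ (2 + 2 * n - 2 * k))⁻¹ *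
        ∫ y in a..b, (r y : ℂ) * ((y : ℂ) ^ (3 + 2 * k))⁻¹ := by
    rw [Finset.mul_sum]
    exact Finset.sum_congr rfl fun k _ => by ring
  rw [this, ← hmain]
  ring

lemma pdC_zero {M : ℕ} {J : Finset ℕ} {F : (ℕ → ℝ) → (ℕ → ℂ) → ℂ} (hF : SmoothFam M J F)
    (ρ : ℕ → ℝ) (z : ℕ → ℂ) (l : ℕ) (hl : M < l) : pdC (fun σ => F σ z) l ρ = 0 := by
  obtain ⟨Ft, -, -, h⟩ := hF
  unfold pdC
  have : (fun t : ℝ => F (Function.update ρ l t) z) = fun _ => F ρ z := by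
    funext t
    rw [h, h]
    congr 2
    funext i
    have : (i : ℕ) ≠ l := by have := i.2; omega
    simp [Function.update_of_ne this]
  simp only [this, deriv_const]

end NCQFT

open NCQFT in
/-- (Lemma 5)  For `ϱ` the moments of the measure,
`K̂_{z₁}((2λ)³Â†_{z_J,z₁}F) = (8λ³/z₁²)(Σ_{l≤M}(3+2l)(∂F/∂ϱ_l)Σ_{k≤l}ϱ_k/z₁^{2+2l−2k}
  + Σ_{β∈J}(1/z_β)∂F/∂z_β)` at every admissible `z₁`. -/
theorem stmt15 (a b s nbar : ℝ) (r : ℝ → ℝ)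
    (ha : 0 < a) (hab : a < b)
    (hr : ContinuousOn r (Set.Icc a b)) (hrpos : ∀ y ∈ Set.Icc a b, 0 ≤ r y)
    (hs : 0 < s) (hρ0 : moment a b s r 0 ≠ 0)
    (lam : ℝ) (J : Finset ℕ) (M : ℕ)
    (F : (ℕ → ℝ) → (ℕ → ℂ) → ℂ) (hF : SmoothFam M J F)
    (z : ℕ → ℂ) (hzJ : ∀ i ∈ J, z i ≠ 0)
    (z1 : ℂ) (hz1 : Admissible a b z1) :
    Khat a b s nbar r
        (fun w => (2 * (lam : ℂ)) ^ 3 * AdagFree J F (moment a b s r) z w) z1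
      = (8 * (lam : ℂ) ^ 3 / z1 ^ 2) *
        ((∑ l ∈ Finset.range (M + 1), (3 + 2 * (l : ℂ)) *
            pdC (fun σ => F σ z) l (moment a b s r) *
            ∑ k ∈ Finset.range (l + 1), (moment a b s r k : ℂ) / z1 ^ (2 + 2 * l - 2 * k))
         + ∑ β ∈ J, (1 / z β) *
            deriv (fun v => F (moment a b s r) (Function.update z β v)) (z β)) := by
  have hρ : (moment a b s r 0 : ℂ) ≠ 0 := Complex.ofReal_ne_zero.mpr hρ0
  have hz0 := hz1.1
  set ρ := moment a b s r with hρdef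
  have hm := hasK_mono a b s nbar r ha hab hr z1 hz1
  have h0 : HasK a b s nbar r z1 (fun w => (w ^ 3)⁻¹) ((ρ 0 : ℂ) / z1 ^ 2) := by
    simpa using hm 0
  have hA : (fun w => (2 * (lam : ℂ)) ^ 3 * AdagFree J F ρ z w) = fun w =>
      (2 * (lam : ℂ)) ^ 3 * ((∑ l ∈ Finset.range (M + 1),
        (-((3 + 2 * (l : ℂ)) * ρ (l + 1) / ρ 0 * pdC (fun σ => F σ z) l ρ) * (w ^ 3)⁻¹ +
          ((3 + 2 * (l : ℂ)) * pdC (fun σ => F σ z) l ρ) * (w ^ (3 + 2 * (l + 1)))⁻¹)) +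
        ∑ i ∈ J, (1 / ((ρ 0 : ℂ) * z i) *
          deriv (fun v => F ρ (Function.update z i v)) (z i)) * (w ^ 3)⁻¹) := by
    funext w
    unfold AdagFree
    congr 2
    · rw [tsum_eq_sum (s := Finset.range (M + 1))]
      · refine Finset.sum_congr rfl fun l _ => ?_
        have : 5 + 2 * l = 3 + 2 * (l + 1) := by ring
        rw [this]
        simp only [div_eq_mul_inv, mul_inv]
        ring
      · intro l hl
        rw [pdC_zero hF, mul_zero]
        simpa using hl
    · refine Finset.sum_congr rfl fun i _ => ?_
      simp only [div_eq_mul_inv, mul_inv]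
      ring
  rw [hA]
  have hK := HasK.cmul ((2 * (lam : ℂ)) ^ 3) (HasK.add
    (HasK.sum (Finset.range (M + 1)) fun l _ =>
      (h0.cmul (-((3 + 2 * (l : ℂ)) * ρ (l + 1) / ρ 0 * pdC (fun σ => F σ z) l ρ))).add
      ((hm (l + 1)).cmul ((3 + 2 * (l : ℂ)) * pdC (fun σ => F σ z) l ρ)))
    (HasK.sum J fun i _ => h0.cmul (1 / ((ρ 0 : ℂ) * z i) *
          deriv (fun v => F ρ (Function.update z i v)) (z i))))
  rw [hK.2]
  have e8 : (8 * (lam : ℂ) ^ 3 / z1 ^ 2) = (2 * (lam : ℂ)) ^ 3 * (1 / z1 ^ 2) := by ring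
  rw [e8, mul_assoc]
  congr 1
  rw [mul_add, Finset.mul_sum, Finset.mul_sum]
  congr 1
  · refine Finset.sum_congr rfl fun l _ => ?_
    rw [Finset.sum_range_succ]
    have e2 : 2 + 2 * (l + 1) - 2 * (l + 1) = 2 := by omega
    have e : ∑ k ∈ Finset.range (l + 1), (ρ k : ℂ) / z1 ^ (2 + 2 * (l + 1) - 2 * k)
        = (1 / z1 ^ 2) * ∑ k ∈ Finset.range (l + 1), (ρ k : ℂ) / z1 ^ (2 + 2 * l - 2 * k) := by
      rw [Finset.mul_sum]
      refine Finset.sum_congr rfl fun k hk => ?_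
      have hk' : k ≤ l := Nat.lt_succ_iff.mp (Finset.mem_range.mp hk)
      have : 2 + 2 * (l + 1) - 2 * k = (2 + 2 * l - 2 * k) + 2 := by omega
      rw [this, pow_add]
      simp only [div_eq_mul_inv, mul_inv]
      ring
    rw [← hρdef, e, e2]
    field_simp
    ring
  · refine Finset.sum_congr rfl fun i hi => ?_
    have := hzJ i hi
    field_simp
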